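/- arXiv:1801.04360 — 4 statements merged into one kernel-verified Lean document; each statement's English description precedes it below -/
import Mathlib

section
/- Suppose m, n ∈ ℂ and set Θ₀ = n + m and Θ∞ = m − n + 1. If the generic Painlevé-III equation with parameters (Θ₀, Θ∞) admits a rational solution, then m is an integer or n is an integer (i.e., (Θ₀ + Θ∞ − 1)/2 ∈ ℤ or (Θ₀ − Θ∞ + 1)/2 ∈ ℤ). -/
open Complex Polynomial Filter

/-- The generic Painlevé-III equation with parameters `(Θ0, Θinf)` holds for the
function `u` at the point `x`. -/
def PIIIat (Θ0 Θinf : ℂ) (u : ℂ → ℂ) (x : ℂ) : Prop :=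
  deriv (deriv u) x =
    (deriv u x) ^ 2 / u x - deriv u x / x
      + (4 * Θ0 * (u x) ^ 2 + 4 * (1 - Θinf)) / x
      + 4 * (u x) ^ 3 - 4 / u x

/-- The rational function `p/q` is a rational solution of the generic Painlevé-III
equation with parameters `(Θ0, Θinf)`. -/
def IsRatSolutionPIII (Θ0 Θinf : ℂ) (p q : Polynomial ℂ) : Prop :=
  p ≠ 0 ∧ q ≠ 0 ∧ ∀ x : ℂ, x ≠ 0 → p.eval x ≠ 0 → q.eval x ≠ 0 →
    PIIIat Θ0 Θinf (fun y => p.eval y / q.eval y) x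

/-- The bilinear (denominator-free) form of Painlevé-III for `u = p / q`, with parameters
`a = Θ0` and `b = 1 - Θinf`. -/
def BilinearPIII (a b : ℂ) (p q : ℂ[X]) : Prop :=
  X * (q ^ 2 * (p * derivative (derivative p) - derivative p ^ 2)
      - p ^ 2 * (q * derivative (derivative q) - derivative q ^ 2))
    + p * q * (derivative p * q - p * derivative q)
    = C (4 * a) * (p ^ 3 * q) + C (4 * b) * (p * q ^ 3) + C 4 * (X * (p ^ 4 - q ^ 4))

/-- The bilinear form is compatible with the symmetry `u ↦ 1 / u`. -/
lemma BilinearPIII.swap {a b : ℂ} {p q : ℂ[X]} (h : BilinearPIII a b p q) :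
    BilinearPIII (-b) (-a) q p := by
  unfold BilinearPIII at *
  simp only [mul_neg, C_neg]
  linear_combination -h

/-- A common factor of numerator and denominator can be cancelled. -/
lemma BilinearPIII.of_mul_left {a b : ℂ} {g p q : ℂ[X]} (hg : g ≠ 0)
    (h : BilinearPIII a b (g * p) (g * q)) : BilinearPIII a b p q := by
  unfold BilinearPIII at *
  apply mul_left_cancel₀ (pow_ne_zero 4 hg)
  simp only [derivative_mul, derivative_add] at h
  linear_combination h

lemma hasDerivAt_eval_div (p q : ℂ[X]) {y : ℂ} (hq : q.eval y ≠ 0) :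
    HasDerivAt (fun y => p.eval y / q.eval y)
      ((derivative p * q - p * derivative q).eval y / (q ^ 2).eval y) y := by
  convert! (p.hasDerivAt y).div (q.hasDerivAt y) hq using 1
  simp

lemma deriv_deriv_eval_div (p q : ℂ[X]) {x : ℂ} (hq : q.eval x ≠ 0) :
    deriv (deriv fun y => p.eval y / q.eval y) x =
      (derivative (derivative p * q - p * derivative q) * q ^ 2
        - (derivative p * q - p * derivative q) * derivative (q ^ 2)).eval x
        / ((q ^ 2) ^ 2).eval x := by
  have hev : deriv (fun y => p.eval y / q.eval y) =ᶠ[nhds x]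
      fun y => (derivative p * q - p * derivative q).eval y / (q ^ 2).eval y := by
    filter_upwards [q.continuous.continuousAt.eventually_ne hq] with y hy
    exact (hasDerivAt_eval_div p q hy).deriv
  rw [hev.deriv_eq]
  exact (hasDerivAt_eval_div _ _ (by simpa using hq)).deriv

lemma IsRatSolutionPIII.bilinear {Θ0 Θinf : ℂ} {p q : ℂ[X]}
    (h : IsRatSolutionPIII Θ0 Θinf p q) : BilinearPIII Θ0 (1 - Θinf) p q := by
  obtain ⟨hp, hq, h⟩ := h
  have hne : X * p * q ≠ 0 := mul_ne_zero (mul_ne_zero X_ne_zero hp) hq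
  apply mul_left_cancel₀ hne
  apply Polynomial.funext
  intro x
  by_cases hx : x = 0
  · simp [hx]
  by_cases hpx : p.eval x = 0
  · simp [hpx]
  by_cases hqx : q.eval x = 0
  · simp [hqx]
  have hode := h x hx hpx hqx
  unfold PIIIat at hode
  rw [deriv_deriv_eval_div p q hqx, (hasDerivAt_eval_div p q hqx).deriv] at hode
  simp only [eval_mul]
  congr 1
  simp only [eval_mul, eval_sub, eval_add, eval_pow, eval_X, eval_C, derivative_mul,
    derivative_sub, derivative_pow, Nat.cast_ofNat] at hode ⊢
  field_simp at hode
  apply mul_left_cancel₀ hqx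
  linear_combination hode

lemma coeff_mul_four_of_natDegree_le {f g h k : ℂ[X]} {d : ℕ} (hf : f.natDegree ≤ d)
    (hg : g.natDegree ≤ d) (hh : h.natDegree ≤ d) (hk : k.natDegree ≤ d) :
    (f * g * (h * k)).coeff (4 * d) = f.coeff d * g.coeff d * (h.coeff d * k.coeff d) := by
  rw [show 4 * d = (d + d) + (d + d) by ring,
    coeff_mul_add_eq_of_natDegree_le (natDegree_mul_le_of_le hf hg) (natDegree_mul_le_of_le hh hk),
    coeff_mul_add_eq_of_natDegree_le hf hg, coeff_mul_add_eq_of_natDegree_le hh hk]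

lemma coeff_derivative_eq_zero_of_natDegree_le {p : ℂ[X]} {d : ℕ} (hp : p.natDegree ≤ d) :
    (derivative p).coeff d = 0 := by
  rw [coeff_derivative, coeff_eq_zero_of_natDegree_lt (by lia), zero_mul]

lemma natDegree_X_mul_derivative_le {p : ℂ[X]} {d : ℕ} (hp : p.natDegree ≤ d) :
    (X * derivative p).natDegree ≤ d := by
  refine natDegree_le_iff_coeff_eq_zero.2 fun N hN => ?_
  obtain ⟨k, rfl⟩ : ∃ k, N = k + 1 := ⟨N - 1, by lia⟩
  rw [coeff_X_mul, coeff_derivative, coeff_eq_zero_of_natDegree_lt (by lia), zero_mul]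

lemma coeff_X_mul_derivative_derivative_eq_zero {p : ℂ[X]} {d : ℕ} (hp : p.natDegree ≤ d) :
    (X * derivative (derivative p)).coeff d = 0 := by
  cases d with
  | zero => simp
  | succ k =>
    rw [coeff_X_mul, coeff_derivative, coeff_derivative,
      coeff_eq_zero_of_natDegree_lt (by lia), zero_mul, zero_mul]

lemma natDegree_derivative_le_of_le {p : ℂ[X]} {d : ℕ} (hp : p.natDegree ≤ d) :
    (derivative p).natDegree ≤ d :=
  (natDegree_derivative_le p).trans (by lia)

/-- The differential part of the bilinear form does not contribute at the top degree. -/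
lemma coeff_bilinear_eq_zero {p q : ℂ[X]} {d : ℕ} (hp : p.natDegree ≤ d) (hq : q.natDegree ≤ d) :
    (X * (q ^ 2 * (p * derivative (derivative p) - derivative p ^ 2)
      - p ^ 2 * (q * derivative (derivative q) - derivative q ^ 2))
    + p * q * (derivative p * q - p * derivative q)).coeff (4 * d) = 0 := by
  have hp' := natDegree_derivative_le_of_le hp
  have hq' := natDegree_derivative_le_of_le hq
  have hp'' := natDegree_X_mul_derivative_le hp'
  have hq'' := natDegree_X_mul_derivative_le hq'
  have hXp := natDegree_X_mul_derivative_le hp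
  have hXq := natDegree_X_mul_derivative_le hq
  rw [show (X * (q ^ 2 * (p * derivative (derivative p) - derivative p ^ 2)
      - p ^ 2 * (q * derivative (derivative q) - derivative q ^ 2))
    + p * q * (derivative p * q - p * derivative q)) =
      q * q * (p * (X * derivative (derivative p))) - q * q * ((X * derivative p) * derivative p)
      - p * p * (q * (X * derivative (derivative q)))
      + p * p * ((X * derivative q) * derivative q)
      + p * q * (derivative p * q) - p * q * (p * derivative q) by ring]
  simp only [coeff_add, coeff_sub]
  rw [coeff_mul_four_of_natDegree_le hq hq hp hp'', coeff_mul_four_of_natDegree_le hq hq hXp hp',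
    coeff_mul_four_of_natDegree_le hp hp hq hq'', coeff_mul_four_of_natDegree_le hp hp hXq hq',
    coeff_mul_four_of_natDegree_le hp hq hp' hq, coeff_mul_four_of_natDegree_le hp hq hp hq']
  simp [coeff_X_mul_derivative_derivative_eq_zero hp, coeff_X_mul_derivative_derivative_eq_zero hq,
    coeff_derivative_eq_zero_of_natDegree_le hp, coeff_derivative_eq_zero_of_natDegree_le hq]

/-- `u = p / q` tends to a fourth root of unity at infinity. -/
lemma BilinearPIII.coeff_pow_four_eq {a b : ℂ} {p q : ℂ[X]} (h : BilinearPIII a b p q) {d : ℕ}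
    (hp : p.natDegree ≤ d) (hq : q.natDegree ≤ d) : p.coeff d ^ 4 = q.coeff d ^ 4 := by
  have hdeg : ∀ {f g h k : ℂ[X]}, f.natDegree ≤ d → g.natDegree ≤ d → h.natDegree ≤ d →
      k.natDegree ≤ d → (f * g * (h * k)).coeff (4 * d + 1) = 0 := fun hf hg hh hk =>
    coeff_eq_zero_of_natDegree_lt <| Nat.lt_succ_of_le <|
      (natDegree_mul_le_of_le (natDegree_mul_le_of_le hf hg)
        (natDegree_mul_le_of_le hh hk)).trans (by lia)
  have hp' := natDegree_derivative_le_of_le hp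
  have hq' := natDegree_derivative_le_of_le hq
  have hp'' := natDegree_derivative_le_of_le hp'
  have hq'' := natDegree_derivative_le_of_le hq'
  have h1 := congrArg (fun f => coeff f (4 * d + 1)) h
  rw [show (q ^ 2 * (p * derivative (derivative p) - derivative p ^ 2)
      - p ^ 2 * (q * derivative (derivative q) - derivative q ^ 2)) =
      q * q * (p * derivative (derivative p)) - q * q * (derivative p * derivative p)
      - p * p * (q * derivative (derivative q)) + p * p * (derivative q * derivative q) by ring,
    show p * q * (derivative p * q - p * derivative q) =
      p * q * (derivative p * q) - p * q * (p * derivative q) by ring,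
    show p ^ 3 * q = p * p * (p * q) by ring, show p * q ^ 3 = p * q * (q * q) by ring,
    show p ^ 4 = p * p * (p * p) by ring, show q ^ 4 = q * q * (q * q) by ring] at h1
  simp only [coeff_add, coeff_sub, coeff_C_mul, coeff_X_mul] at h1
  rw [hdeg hp hq hp' hq, hdeg hp hq hp hq', hdeg hp hp hp hq, hdeg hp hq hq hq,
    coeff_mul_four_of_natDegree_le hq hq hp hp'', coeff_mul_four_of_natDegree_le hq hq hp' hp',
    coeff_mul_four_of_natDegree_le hp hp hq hq'', coeff_mul_four_of_natDegree_le hp hp hq' hq',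
    coeff_mul_four_of_natDegree_le hp hp hp hp, coeff_mul_four_of_natDegree_le hq hq hq hq,
    coeff_derivative_eq_zero_of_natDegree_le hp, coeff_derivative_eq_zero_of_natDegree_le hq,
    coeff_derivative_eq_zero_of_natDegree_le hp', coeff_derivative_eq_zero_of_natDegree_le hq'] at h1
  linear_combination -h1 / 4

/-- The `1 / x` term of the expansion of `u = c + s / q` at infinity. -/
lemma BilinearPIII.coeff_at_infinity {a b c : ℂ} {q s : ℂ[X]} (h : BilinearPIII a b (C c * q + s) q)
    (hc : c ^ 4 = 1) (hq : q ≠ 0) (hs : s.degree < q.degree) :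
    a * c ^ 3 * q.leadingCoeff + b * c * q.leadingCoeff
      + 4 * c ^ 3 * (X * s).coeff q.natDegree = 0 := by
  set d := q.natDegree with hd
  have hqd : q.natDegree ≤ d := le_rfl
  have hsd : s.natDegree ≤ d := natDegree_le_natDegree hs.le
  have hs0 : s.coeff d = 0 := coeff_eq_zero_of_degree_lt (by rwa [hd, ← degree_eq_natDegree hq])
  have hXs : (X * s).natDegree ≤ d := by
    refine natDegree_le_iff_coeff_eq_zero.2 fun N hN => ?_
    obtain ⟨k, rfl⟩ : ∃ k, N = k + 1 := ⟨N - 1, by lia⟩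
    rw [coeff_X_mul]
    rcases (show d ≤ k by lia).eq_or_lt with rfl | hk
    · exact hs0
    · exact coeff_eq_zero_of_natDegree_lt (by lia)
  have hpd : (C c * q + s).natDegree ≤ d :=
    natDegree_add_le_of_degree_le (natDegree_C_mul_le _ _) hsd
  have hp0 : (C c * q + s).coeff d = c * q.leadingCoeff := by
    rw [coeff_add, hs0, coeff_C_mul, add_zero]; rfl
  have h1 := congrArg (fun f => coeff f (4 * d)) h
  have hC : (C c : ℂ[X]) ^ 4 = 1 := by rw [← C_pow, hc, C_1]
  have hexp : X * ((C c * q + s) ^ 4 - q ^ 4) = C (4 * c ^ 3) * (q * q * (q * (X * s)))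
      + C (6 * c ^ 2) * (q * q * (s * (X * s))) + C (4 * c) * (q * s * (s * (X * s)))
      + s * s * (s * (X * s)) := by
    simp only [C_mul, C_pow, C_ofNat]
    linear_combination X * q ^ 4 * hC
  rw [hexp] at h1
  generalize C c * q + s = p at h1 hpd hp0
  rw [show p ^ 3 * q = p * p * (p * q) by ring, show p * q ^ 3 = p * q * (q * q) by ring] at h1
  simp only [coeff_bilinear_eq_zero hpd hqd] at h1
  simp only [coeff_add, coeff_C_mul] at h1
  rw [coeff_mul_four_of_natDegree_le hpd hpd hpd hqd, coeff_mul_four_of_natDegree_le hpd hqd hqd hqd,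
    coeff_mul_four_of_natDegree_le hqd hqd hqd hXs, coeff_mul_four_of_natDegree_le hqd hqd hsd hXs,
    coeff_mul_four_of_natDegree_le hqd hsd hsd hXs, coeff_mul_four_of_natDegree_le hsd hsd hsd hXs,
    hs0, hp0, show q.coeff d = q.leadingCoeff from rfl] at h1
  have hlc : q.leadingCoeff ≠ 0 := leadingCoeff_ne_zero.2 hq
  apply mul_left_cancel₀ (pow_ne_zero 3 hlc)
  linear_combination -h1 / 4

/-- All nonzero poles of `u = p / q` are simple with residue `±1/2`. -/
lemma BilinearPIII.sq_eval_derivative {a b : ℂ} {p q : ℂ[X]} (h : BilinearPIII a b p q) {r : ℂ}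
    (hr : q.eval r = 0) (hr0 : r ≠ 0) (hp : p.eval r ≠ 0) :
    (derivative q).eval r ^ 2 = 4 * p.eval r ^ 2 := by
  have h1 := congrArg (eval r) h
  simp only [eval_mul, eval_sub, eval_add, eval_pow, eval_X, eval_C, hr] at h1
  have h2 : r * p.eval r ^ 2 * ((derivative q).eval r ^ 2) =
      r * p.eval r ^ 2 * (4 * p.eval r ^ 2) := by linear_combination h1
  exact mul_left_cancel₀ (mul_ne_zero hr0 (pow_ne_zero 2 hp)) h2

/-- The residues of `s / q` at simple poles sum to minus the residue at infinity. -/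
lemma coeff_X_mul_eq_sum_residues {q s : ℂ[X]} (hq : q ≠ 0) (hs : s.degree < q.degree)
    (hsimple : ∀ r, q.eval r = 0 → (derivative q).eval r ≠ 0) :
    (X * s).coeff q.natDegree =
      q.leadingCoeff * ∑ r ∈ q.roots.toFinset, s.eval r / (derivative q).eval r := by
  have hnodup : q.roots.Nodup := by
    rw [Multiset.nodup_iff_count_le_one]
    intro r
    rw [count_roots]
    by_contra! hlt
    obtain ⟨h0, h1⟩ := (one_lt_rootMultiplicity_iff_isRoot hq).1 hlt
    exact hsimple r h0 h1
  have hcard : q.roots.card = q.natDegree := (IsAlgClosed.splits q).natDegree_eq_card_roots.symm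
  have hfcard : q.roots.toFinset.card = q.natDegree := by
    rw [Multiset.toFinset_card_of_nodup hnodup, hcard]
  have hfac : q = C q.leadingCoeff * Lagrange.nodal q.roots.toFinset id := by
    conv_lhs => rw [← C_leadingCoeff_mul_prod_multiset_X_sub_C hcard]
    rw [Lagrange.nodal_eq, Finset.prod_multiset_map_count]
    congr 1
    refine Finset.prod_congr rfl fun r hr => ?_
    rw [Multiset.count_eq_one_of_mem hnodup (Multiset.mem_toFinset.1 hr), pow_one]
    rfl
  have hlc : q.leadingCoeff ≠ 0 := leadingCoeff_ne_zero.2 hq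
  have hder : ∀ r ∈ q.roots.toFinset, (derivative q).eval r =
      q.leadingCoeff * ∏ j ∈ q.roots.toFinset.erase r, (r - j) := by
    intro r hr
    have h1 := Lagrange.eval_nodal_derivative_eval_node_eq (v := id) hr
    rw [Lagrange.eval_nodal] at h1
    conv_lhs => rw [hfac]
    rw [derivative_C_mul, eval_C_mul]
    exact congrArg (q.leadingCoeff * ·) h1
  have hdeg : s.degree < (q.roots.toFinset.card : WithBot ℕ) := by
    rw [hfcard, ← degree_eq_natDegree hq]; exact hs
  have hsum := Lagrange.coeff_eq_sum (v := id) Function.injective_id.injOn hdeg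
  have hcoeff : (X * s).coeff q.natDegree = s.coeff (q.natDegree - 1) := by
    rcases Nat.eq_zero_or_pos q.natDegree with h0 | hpos
    · have : s = 0 := by
        rw [← degree_eq_bot]
        rw [degree_eq_natDegree hq, h0] at hs
        exact Nat.WithBot.lt_zero_iff.1 hs
      simp [this]
    · obtain ⟨k, hk⟩ : ∃ k, q.natDegree = k + 1 := ⟨q.natDegree - 1, by lia⟩
      rw [hk, coeff_X_mul, Nat.add_sub_cancel]
  rw [hcoeff, ← hfcard, hsum, Finset.mul_sum]
  refine Finset.sum_congr rfl fun r hr => ?_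
  rw [hder r hr]
  simp only [id]
  field_simp

/-- When `u = p / q` has no pole at the origin, the residue theorem gives integrality. -/
lemma BilinearPIII.exists_int {a b : ℂ} {p q : ℂ[X]} (h : BilinearPIII a b p q)
    (hpq : IsCoprime p q) (hp : p ≠ 0) (hq : q ≠ 0) (hq0 : q.eval 0 ≠ 0) :
    ∃ k : ℤ, a + b = 2 * k ∨ a - b = 2 * k := by
  have hpr : ∀ r, q.eval r = 0 → p.eval r ≠ 0 := by
    intro r hr hp0
    obtain ⟨f, g, hfg⟩ := hpq
    simpa [hr, hp0] using congrArg (eval r) hfg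
  have hsq : ∀ r, q.eval r = 0 → (derivative q).eval r ^ 2 = 4 * p.eval r ^ 2 := by
    intro r hr
    refine h.sq_eval_derivative hr ?_ (hpr r hr)
    rintro rfl
    exact hq0 hr
  have hsimple : ∀ r, q.eval r = 0 → (derivative q).eval r ≠ 0 := by
    intro r hr h0
    have := hsq r hr
    rw [h0] at this
    exact hpr r hr (by simpa using this)
  have hdeg : p.natDegree = q.natDegree := by
    by_contra hne
    rcases lt_or_gt_of_ne hne with hlt | hlt
    · have := (h.coeff_pow_four_eq hlt.le le_rfl).symm
      rw [coeff_eq_zero_of_natDegree_lt hlt] at this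
      simp [hq] at this
    · have := h.coeff_pow_four_eq le_rfl hlt.le
      rw [coeff_eq_zero_of_natDegree_lt hlt] at this
      simp [hp] at this
  have hlq : q.leadingCoeff ≠ 0 := leadingCoeff_ne_zero.2 hq
  have hlead := h.coeff_pow_four_eq hdeg.le le_rfl
  rw [← hdeg, coeff_natDegree, hdeg, coeff_natDegree] at hlead
  set c := p.leadingCoeff / q.leadingCoeff with hcdef
  have hc : c ^ 4 = 1 := by rw [hcdef, div_pow, hlead, div_self (pow_ne_zero 4 hlq)]
  have hc0 : c ≠ 0 := fun h0 => by simp [h0] at hc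
  have hs : (p - C c * q).degree < q.degree := by
    have hcq : (C c * q).degree = q.degree := degree_C_mul hc0
    have hpq' : p.degree = q.degree := by
      rw [degree_eq_natDegree hp, degree_eq_natDegree hq, hdeg]
    rw [← hpq']
    refine degree_sub_lt_left (hpq'.trans hcq.symm) hp ?_
    rw [leadingCoeff_mul, leadingCoeff_C, hcdef, div_mul_cancel₀ _ hlq]
  have hinf := BilinearPIII.coeff_at_infinity (s := p - C c * q)
    (by rwa [add_sub_cancel]) hc hq hs
  rw [coeff_X_mul_eq_sum_residues hq hs hsimple] at hinf
  obtain ⟨k, hk⟩ : ∃ k : ℤ,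
      2 * ∑ r ∈ q.roots.toFinset, (p - C c * q).eval r / (derivative q).eval r = k := by
    rw [Finset.mul_sum]
    have hterm : ∀ r ∈ q.roots.toFinset, ∃ k : ℤ,
        2 * ((p - C c * q).eval r / (derivative q).eval r) = k := by
      intro r hr
      have hr' : q.eval r = 0 := (mem_roots hq).1 (Multiset.mem_toFinset.1 hr)
      rw [eval_sub, eval_mul, hr', mul_zero, sub_zero]
      have hmul : ((derivative q).eval r - 2 * p.eval r) * ((derivative q).eval r + 2 * p.eval r)
          = 0 := by linear_combination hsq r hr'
      rcases mul_eq_zero.1 hmul with h1 | h1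
      · refine ⟨1, ?_⟩
        have := hsimple r hr'
        field_simp
        push_cast
        linear_combination -h1
      · refine ⟨-1, ?_⟩
        have := hsimple r hr'
        field_simp
        push_cast
        linear_combination h1
    choose! f hf using hterm
    exact ⟨∑ r ∈ q.roots.toFinset, f r, by rw [Finset.sum_congr rfl hf]; push_cast; rfl⟩
  have hlin : a * c ^ 2 + b + 2 * c ^ 2 * k = 0 := by
    apply mul_left_cancel₀ (mul_ne_zero hc0 hlq)
    rw [← hk]
    linear_combination hinf
  have hc2 : (c ^ 2 - 1) * (c ^ 2 + 1) = 0 := by linear_combination hc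
  refine ⟨-k, ?_⟩
  push_cast
  rcases mul_eq_zero.1 hc2 with h1 | h1
  · left
    linear_combination hlin - (a + 2 * k) * h1
  · right
    linear_combination -hlin + (a + 2 * k) * h1

/-- If Painlevé-III with `Θ0 = n + m`, `Θinf = m - n + 1` has a rational solution,
then `m ∈ ℤ` or `n ∈ ℤ`. -/
theorem rational_solution_implies_integer_parameter (m n : ℂ)
    (h : ∃ p q : Polynomial ℂ, IsRatSolutionPIII (n + m) (m - n + 1) p q) :
    (∃ k : ℤ, m = k) ∨ (∃ k : ℤ, n = k) := by
  obtain ⟨p, q, h⟩ := h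
  obtain ⟨hp, hq, -⟩ := id h
  have hbil := h.bilinear
  obtain ⟨p₁, hp₁⟩ := EuclideanDomain.gcd_dvd_left p q
  obtain ⟨q₁, hq₁⟩ := EuclideanDomain.gcd_dvd_right p q
  have hg : EuclideanDomain.gcd p q ≠ 0 := fun h0 => hp (by rw [hp₁, h0, zero_mul])
  have hp₁_ne : p₁ ≠ 0 := fun h0 => hp (by rw [hp₁, h0, mul_zero])
  have hq₁_ne : q₁ ≠ 0 := fun h0 => hq (by rw [hq₁, h0, mul_zero])
  have hcop : IsCoprime p₁ q₁ := by
    refine ⟨EuclideanDomain.gcdA p q, EuclideanDomain.gcdB p q, mul_left_cancel₀ hg ?_⟩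
    linear_combination -EuclideanDomain.gcd_eq_gcd_ab p q
      - EuclideanDomain.gcdA p q * hp₁ - EuclideanDomain.gcdB p q * hq₁
  have hbil₁ : BilinearPIII (n + m) (n - m) p₁ q₁ := by
    refine BilinearPIII.of_mul_left hg ?_
    rw [← hp₁, ← hq₁]
    convert hbil using 1
    ring
  have hhalf : ∀ {w z : ℂ}, 2 * w = 2 * z → w = z := fun h => mul_left_cancel₀ two_ne_zero h
  by_cases hq0 : q₁.eval 0 = 0
  · have hp0 : p₁.eval 0 ≠ 0 := by
      intro hp0
      obtain ⟨f, g, hfg⟩ := hcop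
      simpa [hq0, hp0] using congrArg (eval 0) hfg
    obtain ⟨k, hk | hk⟩ := hbil₁.swap.exists_int hcop.symm hq₁_ne hp₁_ne hp0
    · refine .inr ⟨-k, hhalf ?_⟩
      push_cast
      linear_combination -hk
    · exact .inl ⟨k, hhalf (by linear_combination hk)⟩
  · obtain ⟨k, hk | hk⟩ := hbil₁.exists_int hcop hp₁_ne hq₁_ne hq0
    · exact .inr ⟨k, hhalf (by linear_combination hk)⟩
    · exact .inl ⟨k, hhalf (by linear_combination hk)⟩
end

section
/- Let m ∈ ℂ with m ∉ ℤ, and set Θ₀ = m, Θ∞ = m + 1 (the case n = 0). Then the only rational solutions of the generic Painlevé-III equation with parameters (Θ₀, Θ∞) are the constant functions u ≡ 1 and u ≡ −1. -/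
open Complex Polynomial Filter

namespace PainleveIII

/-- The derivative part of Painlevé-III for `p / q`, with denominators cleared. -/
noncomputable def derivPart (p q : ℂ[X]) : ℂ[X] :=
  (wronskian q p + X * derivative (wronskian q p)) * (p * q)
    - X * wronskian q p * derivative (p * q)

/-- The polynomial form of Painlevé-III with parameters `(m, m + 1)`. -/
def PolyEq (m : ℂ) (p q : ℂ[X]) : Prop :=
  derivPart p q = (p ^ 2 - q ^ 2) * (C (4 * m) * (p * q) + 4 * X * (p ^ 2 + q ^ 2))

theorem hasDerivAt_div (p q : ℂ[X]) {x : ℂ} (hx : q.eval x ≠ 0) :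
    HasDerivAt (fun y => p.eval y / q.eval y)
      ((wronskian q p).eval x / (q ^ 2).eval x) x := by
  refine ((p.hasDerivAt x).div (q.hasDerivAt x) hx).congr_deriv ?_
  simp only [wronskian, eval_sub, eval_mul, eval_pow]
  ring

theorem deriv_div_eventuallyEq (p q : ℂ[X]) {x : ℂ} (hx : q.eval x ≠ 0) :
    deriv (fun y => p.eval y / q.eval y) =ᶠ[nhds x]
      fun y => (wronskian q p).eval y / (q ^ 2).eval y := by
  filter_upwards [q.continuous.continuousAt.eventually_ne hx] with y hy
  exact (hasDerivAt_div p q hy).deriv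

theorem polyEq_of_isRatSolution {m : ℂ} {p q : ℂ[X]}
    (h : IsRatSolutionPIII m (m + 1) p q) : PolyEq m p q := by
  obtain ⟨hp, hq, h⟩ := h
  have hne : X * (p * q) ≠ 0 := mul_ne_zero X_ne_zero (mul_ne_zero hp hq)
  refine mul_left_cancel₀ hne (Polynomial.funext fun x => ?_)
  by_cases hz : x * (p.eval x * q.eval x) = 0
  · simp [hz]
  simp only [mul_eq_zero, not_or] at hz
  obtain ⟨hx, hpx, hqx⟩ := hz
  have key := h x hx hpx hqx
  have hq2 : (q ^ 2).eval x ≠ 0 := by simpa using hqx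
  unfold PIIIat at key
  rw [(deriv_div_eventuallyEq p q hqx).deriv_eq, (hasDerivAt_div p q hqx).deriv,
    (hasDerivAt_div _ _ hq2).deriv] at key
  simp only [derivPart, eval_mul, eval_sub, eval_add, eval_pow, eval_X, eval_C, eval_ofNat,
    derivative_mul]
  generalize hw : wronskian q p = w at *
  have hw' : w.eval x = q.eval x * (derivative p).eval x - (derivative q).eval x * p.eval x := by
    simp [← hw, wronskian]
  simp only [wronskian, eval_mul, eval_sub, eval_pow, derivative_pow, eval_C] at key
  field_simp at key
  norm_num at key
  clear hw h
  generalize w.eval x = W at *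
  generalize (derivative w).eval x = W' at *
  generalize (derivative p).eval x = P' at *
  generalize (derivative q).eval x = Q' at *
  generalize p.eval x = P at *
  generalize q.eval x = Q at *
  linear_combination x * P * key + x * P * Q * (x * W) * hw'

theorem derivPart_mul (d p q : ℂ[X]) : derivPart (d * p) (d * q) = d ^ 4 * derivPart p q := by
  simp only [derivPart, wronskian, derivative_mul, derivative_sub, derivative_add]
  ring

theorem PolyEq.of_mul {m : ℂ} {d p q : ℂ[X]} (hd : d ≠ 0) (h : PolyEq m (d * p) (d * q)) :
    PolyEq m p q := by
  unfold PolyEq at *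
  rw [derivPart_mul] at h
  refine mul_left_cancel₀ (pow_ne_zero 4 hd) (h.trans ?_)
  ring

theorem natDegree_X_mul_derivative_le (p : ℂ[X]) :
    (X * derivative p).natDegree ≤ p.natDegree := by
  by_cases h : p.natDegree = 0
  · rw [eq_C_of_natDegree_eq_zero h]; simp
  · have := natDegree_mul_le (p := X) (q := derivative p)
    have := natDegree_derivative_lt h
    have := natDegree_X_le (R := ℂ)
    omega

theorem natDegree_derivPart_le {p q : ℂ[X]} {n : ℕ} (hp : p.natDegree ≤ n)
    (hq : q.natDegree ≤ n) :
    (derivPart p q).natDegree ≤ (wronskian q p).natDegree + (n + n) := by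
  have hpq := natDegree_mul_le_of_le hp hq
  have h : derivPart p q = (wronskian q p + X * derivative (wronskian q p)) * (p * q)
      - wronskian q p * (X * derivative (p * q)) := by
    unfold derivPart; ring
  rw [h]
  refine natDegree_sub_le_of_le (natDegree_mul_le_of_le (natDegree_add_le_of_degree_le le_rfl
    (natDegree_X_mul_derivative_le _)) hpq) (natDegree_mul_le_of_le le_rfl
    ((natDegree_X_mul_derivative_le _).trans hpq)) |>.trans (max_self _).le

theorem coeff_derivPart_eq_zero {p q s : ℂ[X]} {n k : ℕ} (hp : p.natDegree ≤ n)
    (hq : q.natDegree ≤ n) (hw : wronskian q p = wronskian q s)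
    (h : q.natDegree + s.natDegree + (n + n) ≤ k) :
    (derivPart p q).coeff k = 0 := by
  by_cases hw0 : wronskian q p = 0
  · simp [derivPart, hw0]
  · refine coeff_eq_zero_of_natDegree_lt ?_
    have h1 := natDegree_derivPart_le hp hq
    have h2 := natDegree_wronskian_lt_add (hw ▸ hw0)
    rw [hw] at h1
    omega

theorem natDegree_sq_le {p : ℂ[X]} {n : ℕ} (hp : p.natDegree ≤ n) :
    (p ^ 2).natDegree ≤ 2 * n := natDegree_pow_le_of_le 2 hp

/-- The leading behaviour at infinity: `(p / q) ^ 4` tends to `1`. -/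
theorem PolyEq.coeff_pow_four_eq {m : ℂ} {p q : ℂ[X]} (h : PolyEq m p q) {n : ℕ}
    (hp : p.natDegree ≤ n) (hq : q.natDegree ≤ n) : p.coeff n ^ 4 = q.coeff n ^ 4 := by
  have e : X * (C 4 * (p ^ 4 - q ^ 4)) = derivPart p q - (p ^ 2 - q ^ 2) * (C (4 * m) * (p * q)) := by
    rw [show derivPart p q = _ from h, show (C 4 : ℂ[X]) = 4 from rfl]; ring
  have h1 : (derivPart p q).coeff (4 * n + 1) = 0 :=
    coeff_derivPart_eq_zero hp hq rfl (by omega)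
  have h2 : ((p ^ 2 - q ^ 2) * (C (4 * m) * (p * q))).natDegree ≤ 2 * n + (n + n) :=
    natDegree_mul_le_of_le ((natDegree_sub_le_of_le (natDegree_sq_le hp)
      (natDegree_sq_le hq)).trans (max_self _).le)
      ((natDegree_C_mul_le _ _).trans (natDegree_mul_le_of_le hp hq))
  have h3 := congrArg (fun f => f.coeff (4 * n + 1)) e
  simp only [coeff_X_mul, coeff_C_mul, coeff_sub, h1, coeff_pow_of_natDegree_le hp,
    coeff_pow_of_natDegree_le hq] at h3
  rw [coeff_eq_zero_of_natDegree_lt (h2.trans_lt (by omega))] at h3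
  simpa [sub_eq_zero] using h3

/-- A solution asymptotic to `a = ±1` at infinity is constant. -/
theorem PolyEq.eq_of_sq_eq_one {m a : ℂ} {p q : ℂ[X]} (h : PolyEq m p q) (hq0 : q ≠ 0)
    (ha : a ^ 2 = 1) (hp : p.natDegree ≤ q.natDegree)
    (hpa : p.coeff q.natDegree = a * q.leadingCoeff) : p = C a * q := by
  obtain ⟨s, hs⟩ : ∃ s, s = p - C a * q := ⟨_, rfl⟩
  by_contra hne
  have hs0 : s ≠ 0 := by rw [hs]; exact sub_ne_zero.2 hne
  have hw : wronskian q p = wronskian q s := by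
    rw [hs]; simp only [wronskian, derivative_sub, derivative_mul, derivative_C]; ring
  have hC : (C a : ℂ[X]) ^ 2 = 1 := by rw [← C_pow, ha, C_1]
  set n := q.natDegree with hn
  have hb : (p + C a * q).natDegree ≤ n :=
    natDegree_add_le_of_degree_le hp (natDegree_C_mul_le _ _)
  have hD : (C (4 * m) * (p * q) + C 4 * (X * (p ^ 2 + q ^ 2))).natDegree ≤ 2 * n + 1 := by
    refine natDegree_add_le_of_degree_le ((natDegree_C_mul_le _ _).trans
      ((natDegree_mul_le_of_le hp hn.ge).trans (by omega))) ((natDegree_C_mul_le _ _).trans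
      ((natDegree_mul_le_of_le natDegree_X_le (natDegree_add_le_of_degree_le
        (natDegree_sq_le hp) (natDegree_sq_le hn.ge))).trans (by omega)))
  have e : derivPart p q = s * (p + C a * q) *
      (C (4 * m) * (p * q) + C 4 * (X * (p ^ 2 + q ^ 2))) := by
    rw [show derivPart p q = _ from h, hs, show (C 4 : ℂ[X]) = 4 from rfl]
    linear_combination ((C (4 * m) * (p * q) + 4 * X * (p ^ 2 + q ^ 2))) * q ^ 2 * hC
  have h0 : (derivPart p q).coeff (s.natDegree + n + (2 * n + 1)) = 0 :=
    coeff_derivPart_eq_zero hp hn.ge hw (by omega)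
  rw [e, coeff_mul_add_eq_of_natDegree_le (natDegree_mul_le_of_le le_rfl hb) hD,
    coeff_mul_add_eq_of_natDegree_le le_rfl hb] at h0
  have h1 : (C (4 * m) * (p * q)).coeff (2 * n + 1) = 0 :=
    coeff_eq_zero_of_natDegree_lt (((natDegree_C_mul_le _ _).trans
      (natDegree_mul_le_of_le hp hn.ge)).trans_lt (by omega))
  simp only [coeff_add, h1, coeff_C_mul, coeff_X_mul, coeff_pow_of_natDegree_le hp,
    coeff_pow_of_natDegree_le hn.ge, hpa, coeff_natDegree] at h0
  rw [← leadingCoeff, mul_pow, ha] at h0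
  have ha0 : a ≠ 0 := by rintro rfl; norm_num at ha
  ring_nf at h0
  simp [hs0, ha0, hq0] at h0

/-- A solution asymptotic to `a = ±i` at infinity satisfies `p / q = a - m / (2 x) + …`. -/
theorem PolyEq.coeff_X_mul_sub {m a : ℂ} {p q : ℂ[X]} (h : PolyEq m p q) (hq0 : q ≠ 0)
    (ha : a ^ 2 = -1) (hp : p.natDegree ≤ q.natDegree)
    (hpa : p.coeff q.natDegree = a * q.leadingCoeff) :
    (X * (p - C a * q)).coeff q.natDegree = -(m / 2) * q.leadingCoeff := by
  have hC : (C a : ℂ[X]) ^ 2 = -1 := by rw [← C_pow, ha, C_neg, C_1]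
  have hq' : q.coeff q.natDegree = q.leadingCoeff := rfl
  set n := q.natDegree with hn
  have hb : (p + C a * q).natDegree ≤ n :=
    natDegree_add_le_of_degree_le hp (natDegree_C_mul_le _ _)
  have hXs : (X * (p - C a * q)).natDegree ≤ n := by
    rw [natDegree_le_iff_coeff_eq_zero]
    rintro (_ | k) hk
    · simp
    · rw [coeff_X_mul, coeff_sub, coeff_C_mul]
      rcases (Nat.lt_succ_iff.1 hk).eq_or_lt with rfl | hk
      · rw [hpa, hq', sub_self]
      · rw [coeff_eq_zero_of_natDegree_lt (hp.trans_lt hk), coeff_eq_zero_of_natDegree_lt hk]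
        simp
  have e : derivPart p q = (p ^ 2 - q ^ 2) * (C (4 * m) * (p * q) +
      C 4 * (X * (p - C a * q) * (p + C a * q))) := by
    rw [show derivPart p q = _ from h, show (C 4 : ℂ[X]) = 4 from rfl]
    linear_combination (p ^ 2 - q ^ 2) * 4 * X * q ^ 2 * hC
  have hA : (p ^ 2 - q ^ 2).natDegree ≤ 2 * n :=
    (natDegree_sub_le_of_le (natDegree_sq_le hp) (natDegree_sq_le hn.ge)).trans (max_self _).le
  have hB : (C (4 * m) * (p * q) +
      C 4 * (X * (p - C a * q) * (p + C a * q))).natDegree ≤ n + n :=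
    natDegree_add_le_of_degree_le ((natDegree_C_mul_le _ _).trans
      (natDegree_mul_le_of_le hp hn.ge)) ((natDegree_C_mul_le _ _).trans
      (natDegree_mul_le_of_le hXs hb))
  have h0 : (derivPart p q).coeff (2 * n + (n + n)) = 0 :=
    coeff_derivPart_eq_zero hp hn.ge rfl (by omega)
  rw [e, coeff_mul_add_eq_of_natDegree_le hA hB, coeff_add, coeff_C_mul, coeff_C_mul,
    coeff_mul_add_eq_of_natDegree_le hp hn.ge, coeff_mul_add_eq_of_natDegree_le hXs hb,
    coeff_sub, coeff_add, coeff_C_mul, coeff_pow_of_natDegree_le hp,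
    coeff_pow_of_natDegree_le hn.ge, hpa, hq', mul_pow, ha] at h0
  have ha0 : a ≠ 0 := by rintro rfl; norm_num at ha
  generalize (X * (p - C a * q)).coeff n = c at *
  have h1 : (-16 * a * q.leadingCoeff ^ 3) * (c - -(m / 2) * q.leadingCoeff) = 0 := by
    linear_combination h0
  have h2 : -16 * a * q.leadingCoeff ^ 3 ≠ 0 := by simp [ha0, hq0]
  exact sub_eq_zero.1 ((mul_eq_zero.1 h1).resolve_left h2)

/-- The sum of the residues of `s / q` over the (simple) poles. -/
theorem sum_eval_div_derivative {q s : ℂ[X]} (hq : q ≠ 0) (hnd : q.roots.Nodup)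
    (hs : s.degree < q.degree) :
    ∑ r ∈ q.roots.toFinset, s.eval r / (derivative q).eval r =
      (X * s).coeff q.natDegree / q.leadingCoeff := by
  have hsp := IsAlgClosed.splits q
  have hcard : q.roots.toFinset.card = q.natDegree := by
    rw [Multiset.toFinset_card_of_nodup hnd, hsp.natDegree_eq_card_roots]
  rw [degree_eq_natDegree hq] at hs
  have hsum : (X * s).coeff q.natDegree = s.coeff (q.natDegree - 1) := by
    rcases hn : q.natDegree with _ | k
    · rw [hn] at hs
      have : s = 0 := by simpa [Nat.WithBot.lt_zero_iff] using hs
      simp [this]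
    · simp
  rw [hsum, ← hcard, Lagrange.coeff_eq_sum (v := id) (Function.injective_id.injOn)
    (by rwa [hcard]), Finset.sum_div]
  refine Finset.sum_congr rfl fun r hr => ?_
  rw [div_div]
  congr 1
  have hqn : q = C q.leadingCoeff * Lagrange.nodal q.roots.toFinset id := by
    conv_lhs => rw [hsp.eq_prod_roots]
    congr 1
    rw [Lagrange.nodal, Finset.prod, Multiset.toFinset_val, hnd.dedup]
    rfl
  have he := Lagrange.eval_nodal_derivative_eval_node_eq (v := (id : ℂ → ℂ)) hr
  conv_lhs => rw [hqn]
  rw [derivative_C_mul, eval_C_mul, mul_comm]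
  exact congrArg (· * _) (he.trans (Lagrange.eval_nodal ..))

/-- Poles are simple; nonzero poles have residue `±1/2`, a pole at `0` has residue `-m`. -/
theorem PolyEq.residue {m r : ℂ} {p q : ℂ[X]} (h : PolyEq m p q) (hr : q.eval r = 0)
    (hp : p.eval r ≠ 0) :
    (derivative q).eval r ≠ 0 ∧
      (r ≠ 0 → p.eval r / (derivative q).eval r = 1 / 2 ∨
        p.eval r / (derivative q).eval r = -1 / 2) ∧
      (r = 0 → p.eval r / (derivative q).eval r = -m) := by
  by_cases hr0 : r = 0
  · subst hr0
    obtain ⟨t, rfl⟩ : X ∣ q := by rw [X_dvd_iff, coeff_zero_eq_eval_zero, hr]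
    obtain ⟨e, he⟩ : ∃ e : ℂ[X], X * (4 * p ^ 3 * (p + C m * t) + X * e) = 0 := by
      unfold PolyEq derivPart at h
      generalize wronskian (X * t) p = w at h
      simp only [derivative_mul, derivative_X, C_mul, show (C 4 : ℂ[X]) = 4 from rfl] at h
      refine ⟨w * derivative p * t + w * p * derivative t - derivative w * p * t
        - X * t ^ 2 * (4 * C m * (p * t) + 4 * (p ^ 2 + X ^ 2 * t ^ 2)) + 4 * X * p ^ 2 * t ^ 2, ?_⟩
      linear_combination -h
    have h0 := congrArg (eval 0) ((mul_eq_zero.1 he).resolve_left X_ne_zero)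
    have h1 : p.eval 0 + m * t.eval 0 = 0 := by simpa [hp] using h0
    have ht : t.eval 0 ≠ 0 := fun ht => hp (by simpa [ht] using h1)
    have hd : (derivative (X * t)).eval 0 = t.eval 0 := by simp
    refine ⟨by rwa [hd], fun h => absurd rfl h, fun _ => ?_⟩
    rw [hd, div_eq_iff ht]
    linear_combination h1
  · have h0 := congrArg (eval r) h
    simp only [derivPart, wronskian, derivative_mul, derivative_sub, eval_add, eval_sub, eval_mul,
      eval_pow, eval_X, eval_C, eval_ofNat, hr] at h0
    have h1 : (r * p.eval r ^ 2) *
        (((derivative q).eval r - 2 * p.eval r) * ((derivative q).eval r + 2 * p.eval r)) = 0 := by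
      linear_combination h0
    have h2 := (mul_eq_zero.1 h1).resolve_left (mul_ne_zero hr0 (pow_ne_zero 2 hp))
    have h3 : (derivative q).eval r = 2 * p.eval r ∨ (derivative q).eval r = -(2 * p.eval r) :=
      (mul_eq_zero.1 h2).imp sub_eq_zero.1 eq_neg_of_add_eq_zero_left
    rcases h3 with h3 | h3 <;> rw [h3]
    · exact ⟨by simpa using hp, fun _ => .inl (by field_simp), fun h => absurd h hr0⟩
    · exact ⟨by simpa using hp, fun _ => .inr (by field_simp), fun h => absurd h hr0⟩

theorem sum_half_integers {ι : Type*} (S : Finset ι) (f : ι → ℂ)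
    (h : ∀ i ∈ S, f i = 1 / 2 ∨ f i = -1 / 2) : ∃ k : ℤ, ∑ i ∈ S, f i = k / 2 := by
  refine Finset.sum_induction f (fun z => ∃ k : ℤ, z = k / 2) ?_ ⟨0, by simp⟩ fun i hi => ?_
  · rintro _ _ ⟨k, rfl⟩ ⟨l, rfl⟩
    exact ⟨k + l, by push_cast; ring⟩
  · rcases h i hi with h | h
    · exact ⟨1, by simp [h]⟩
    · exact ⟨-1, by simp [h]⟩

/-- A solution asymptotic to `±i` at infinity forces `m` to be an integer. -/
theorem PolyEq.exists_int_of_sq_eq_neg_one {m a : ℂ} {p q : ℂ[X]} (h : PolyEq m p q)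
    (hco : IsCoprime p q) (hq0 : q ≠ 0) (ha : a ^ 2 = -1) (hp : p.natDegree ≤ q.natDegree)
    (hpa : p.coeff q.natDegree = a * q.leadingCoeff) : ∃ k : ℤ, m = k := by
  have hpr {r : ℂ} (hr : q.eval r = 0) : p.eval r ≠ 0 := fun hpr => by
    obtain ⟨u, v, huv⟩ := hco
    simpa [hr, hpr] using congrArg (eval r) huv
  have hnd : q.roots.Nodup := by
    rw [Multiset.nodup_iff_count_le_one]
    intro r
    rw [count_roots]
    by_contra! hlt
    obtain ⟨h1, h2⟩ := (one_lt_rootMultiplicity_iff_isRoot hq0).1 hlt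
    exact (h.residue h1 (hpr h1)).1 h2
  have hdeg : (p - C a * q).degree < q.degree := by
    rw [degree_eq_natDegree hq0, degree_lt_iff_coeff_zero]
    intro k hk
    rcases hk.eq_or_lt with rfl | hk
    · rw [coeff_sub, coeff_C_mul, hpa, leadingCoeff, sub_self]
    · rw [coeff_sub, coeff_C_mul, coeff_eq_zero_of_natDegree_lt (hp.trans_lt hk),
        coeff_eq_zero_of_natDegree_lt hk]
      simp
  have hsum := sum_eval_div_derivative hq0 hnd hdeg
  rw [h.coeff_X_mul_sub hq0 ha hp hpa, mul_div_cancel_right₀ _ (leadingCoeff_ne_zero.2 hq0)] at hsum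
  have hroot {r : ℂ} (hr : r ∈ q.roots.toFinset) : q.eval r = 0 :=
    (mem_roots hq0).1 (Multiset.mem_toFinset.1 hr)
  have hval : ∀ r ∈ q.roots.toFinset, (p - C a * q).eval r / (derivative q).eval r =
      p.eval r / (derivative q).eval r := fun r hr => by simp [hroot hr]
  rw [Finset.sum_congr rfl hval] at hsum
  obtain ⟨k, hk⟩ := sum_half_integers (q.roots.toFinset.erase 0)
    (fun r => p.eval r / (derivative q).eval r) fun r hr =>
      have hr' := hroot (Finset.mem_of_mem_erase hr)
      (h.residue hr' (hpr hr')).2.1 (Finset.ne_of_mem_erase hr)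
  by_cases h0 : (0 : ℂ) ∈ q.roots.toFinset
  · rw [← Finset.add_sum_erase _ _ h0, hk,
      (h.residue (hroot h0) (hpr (hroot h0))).2.2 rfl] at hsum
    exact ⟨k, by linear_combination (-2) * hsum⟩
  · rw [Finset.erase_eq_of_notMem h0] at hk
    rw [hk] at hsum
    exact ⟨-k, by push_cast; linear_combination 2 * hsum⟩

theorem PolyEq.eq_or_eq_neg_of_isCoprime {m : ℂ} (hm : ¬∃ k : ℤ, m = k) {p q : ℂ[X]}
    (h : PolyEq m p q) (hco : IsCoprime p q) (hp0 : p ≠ 0) (hq0 : q ≠ 0) :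
    p = q ∨ p = -q := by
  have hdeg : p.natDegree = q.natDegree := by
    rcases lt_trichotomy p.natDegree q.natDegree with hlt | heq | hlt
    · have := h.coeff_pow_four_eq hlt.le le_rfl
      rw [coeff_eq_zero_of_natDegree_lt hlt] at this
      exact absurd this.symm (by simpa using hq0)
    · exact heq
    · have := h.coeff_pow_four_eq le_rfl hlt.le
      rw [coeff_eq_zero_of_natDegree_lt hlt] at this
      simp [hp0] at this
  have hl : q.leadingCoeff ≠ 0 := leadingCoeff_ne_zero.2 hq0
  have h4 := h.coeff_pow_four_eq hdeg.le le_rfl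
  obtain ⟨a, hpa⟩ : ∃ a, p.coeff q.natDegree = a * q.leadingCoeff :=
    ⟨_, (div_mul_cancel₀ _ hl).symm⟩
  rw [hpa, coeff_natDegree, mul_pow] at h4
  have ha4 : (a ^ 2 - 1) * (a ^ 2 + 1) = 0 := by
    linear_combination mul_right_cancel₀ (pow_ne_zero 4 hl) (h4.trans (one_mul _).symm)
  rcases mul_eq_zero.1 ha4 with ha | ha
  · have hpq := h.eq_of_sq_eq_one hq0 (sub_eq_zero.1 ha) hdeg.le hpa
    rcases sq_eq_one_iff.1 (sub_eq_zero.1 ha) with rfl | rfl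
    · exact .inl (by simpa using hpq)
    · exact .inr (by simpa using hpq)
  · exact absurd (h.exists_int_of_sq_eq_neg_one hco hq0 (eq_neg_of_add_eq_zero_left ha) hdeg.le hpa)
      hm

theorem PolyEq.eq_or_eq_neg {m : ℂ} (hm : ¬∃ k : ℤ, m = k) {p q : ℂ[X]}
    (h : PolyEq m p q) (hp0 : p ≠ 0) (hq0 : q ≠ 0) : p = q ∨ p = -q := by
  have hd : gcd p q ≠ 0 := fun hd => hp0 ((gcd_eq_zero_iff p q).1 hd).1
  have hco := isCoprime_div_gcd_div_gcd (p := p) hq0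
  obtain ⟨p', hp'⟩ : ∃ p', p' = p / gcd p q := ⟨_, rfl⟩
  obtain ⟨q', hq'⟩ : ∃ q', q' = q / gcd p q := ⟨_, rfl⟩
  have ep := EuclideanDomain.mul_div_cancel' hd (gcd_dvd_left p q)
  have eq := EuclideanDomain.mul_div_cancel' hd (gcd_dvd_right p q)
  rw [← hp', ← hq'] at hco
  rw [← hp'] at ep
  rw [← hq'] at eq
  clear hp' hq'
  generalize gcd p q = d at *
  subst ep eq
  exact (h.of_mul hd |>.eq_or_eq_neg_of_isCoprime hm hco (right_ne_zero_of_mul hp0)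
    (right_ne_zero_of_mul hq0)).imp (by rintro rfl; rfl) (by rintro rfl; ring)

end PainleveIII

/-- For `m ∉ ℤ` and `n = 0` (so `Θ0 = m`, `Θinf = m + 1`), the only rational
solutions of Painlevé-III are the constants `1` and `-1`. -/
theorem rational_solutions_n_zero (m : ℂ) (hm : ¬∃ k : ℤ, m = k) :
    IsRatSolutionPIII m (m + 1) 1 1 ∧
    IsRatSolutionPIII m (m + 1) (-1) 1 ∧
    ∀ p q : Polynomial ℂ, IsRatSolutionPIII m (m + 1) p q → p = q ∨ p = -q := by
  refine ⟨⟨one_ne_zero, one_ne_zero, fun x _ _ _ => ?_⟩,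
    ⟨neg_ne_zero.2 one_ne_zero, one_ne_zero, fun x _ _ _ => ?_⟩, fun p q h =>
    (PainleveIII.polyEq_of_isRatSolution h).eq_or_eq_neg hm h.1 h.2.1⟩
  · simp [PIIIat]
  · simp [PIIIat]
    norm_num
end

section
/- Uniqueness of the rational solution normalized at infinity: fix m ∈ ℂ and n ∈ ℤ, and set Θ₀ = n + m, Θ∞ = m − n + 1. If u₁ and u₂ are rational solutions of the generic Painlevé-III equation with parameters (Θ₀, Θ∞) and both satisfy u_j(x) → 1 as |x| → ∞, then u₁ = u₂ as rational functions (they agree at every point where both are defined). -/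
open Complex Polynomial Filter

/-- A nonzero polynomial has no zeros near infinity. -/
theorem eventually_cobounded_eval_ne_zero {p : Polynomial ℂ} (hp : p ≠ 0) :
    ∀ᶠ x in Bornology.cobounded ℂ, p.eval x ≠ 0 :=
  Bornology.le_cofinite ℂ (p.finite_setOfPred_isRoot hp).eventually_cofinite_notMem

/-- The logarithmic derivative of a polynomial vanishes at infinity. -/
theorem tendsto_eval_derivative_div_eval_cobounded (p : Polynomial ℂ) :
    Tendsto (fun x => p.derivative.eval x / p.eval x) (Bornology.cobounded ℂ) (nhds 0) := by
  rcases eq_or_ne p 0 with rfl | hp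
  · simp
  have h : Tendsto (fun x => (p.roots.map fun r => 1 / (x - r)).sum)
      (Bornology.cobounded ℂ) (nhds (p.roots.map fun _ => (0 : ℂ)).sum) := by
    refine tendsto_multiset_sum _ fun r _ => ?_
    simpa only [one_div, Function.comp_def] using tendsto_inv₀_cobounded.comp (tendsto_sub_const_cobounded r)
  rw [Multiset.sum_map_zero] at h
  refine h.congr' ?_
  filter_upwards [eventually_cobounded_eval_ne_zero hp] with x hx
  exact ((IsAlgClosed.splits p).eval_derivative_div_eval_of_ne_zero hx).symm

theorem deriv_eval_div_eval (p q : Polynomial ℂ) {x : ℂ} (hx : q.eval x ≠ 0) :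
    deriv (fun y => p.eval y / q.eval y) x =
      (p.derivative * q - p * q.derivative).eval x / (q ^ 2).eval x := by
  rw [((p.hasDerivAt x).fun_div (q.hasDerivAt x) hx).deriv]
  simp

theorem analyticAt_eval_div_eval (p q : Polynomial ℂ) {x : ℂ} (hx : q.eval x ≠ 0) :
    AnalyticAt ℂ (fun y => p.eval y / q.eval y) x := by
  have h (r : Polynomial ℂ) : AnalyticAt ℂ (fun y => r.eval y) x :=
    r.differentiable.analyticAt x
  exact (h p).div (h q) hx

/-- The logarithmic derivative of a rational function vanishes at infinity. -/
theorem tendsto_deriv_div_self_cobounded (p : Polynomial ℂ) {q : Polynomial ℂ} (hq : q ≠ 0) :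
    Tendsto (fun x => deriv (fun y => p.eval y / q.eval y) x / (p.eval x / q.eval x))
      (Bornology.cobounded ℂ) (nhds 0) := by
  rcases eq_or_ne p 0 with rfl | hp
  · simp
  have h := (tendsto_eval_derivative_div_eval_cobounded p).sub
    (tendsto_eval_derivative_div_eval_cobounded q)
  rw [sub_zero] at h
  refine h.congr' ?_
  filter_upwards [eventually_cobounded_eval_ne_zero hp,
    eventually_cobounded_eval_ne_zero hq] with x hpx hqx
  rw [deriv_eval_div_eval p q hqx]
  simp only [eval_sub, eval_mul, eval_pow]
  field_simp

theorem deriv_deriv_eval_div_eval (p q : Polynomial ℂ) {x : ℂ} (hx : q.eval x ≠ 0) :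
    deriv (deriv fun y => p.eval y / q.eval y) x =
      deriv (fun y => (p.derivative * q - p * q.derivative).eval y / (q ^ 2).eval y) x := by
  refine EventuallyEq.deriv_eq ?_
  filter_upwards [q.continuous.continuousAt.eventually_ne hx] with y hy
  exact deriv_eval_div_eval p q hy

/-- The ratio of the second derivative of a rational function to the function itself vanishes
at infinity. -/
theorem tendsto_deriv_deriv_div_self_cobounded (p : Polynomial ℂ) {q : Polynomial ℂ}
    (hq : q ≠ 0) :
    Tendsto (fun x => deriv (deriv fun y => p.eval y / q.eval y) x / (p.eval x / q.eval x))
      (Bornology.cobounded ℂ) (nhds 0) := by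
  set r := p.derivative * q - p * q.derivative with hr
  have h := (tendsto_deriv_div_self_cobounded r (pow_ne_zero 2 hq)).mul
    (tendsto_deriv_div_self_cobounded p hq)
  rw [zero_mul] at h
  refine h.congr' ?_
  rcases eq_or_ne r 0 with h0 | h0
  · filter_upwards [eventually_cobounded_eval_ne_zero hq] with x hqx
    rw [deriv_deriv_eval_div_eval p q hqx, ← hr, h0]
    simp
  · filter_upwards [eventually_cobounded_eval_ne_zero hq,
      eventually_cobounded_eval_ne_zero h0] with x hqx hrx
    rw [deriv_deriv_eval_div_eval p q hqx, deriv_eval_div_eval p q hqx, ← hr]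
    refine div_mul_div_cancel₀ (div_ne_zero hrx ?_)
    simpa using hqx

/-- The derivative of a rational function with a finite limit at infinity vanishes at infinity. -/
theorem tendsto_deriv_cobounded {p q : Polynomial ℂ} (hp : p ≠ 0) (hq : q ≠ 0) {l : ℂ}
    (h : Tendsto (fun x => p.eval x / q.eval x) (Bornology.cobounded ℂ) (nhds l)) :
    Tendsto (deriv fun y => p.eval y / q.eval y) (Bornology.cobounded ℂ) (nhds 0) := by
  have h' := (tendsto_deriv_div_self_cobounded p hq).mul h
  rw [zero_mul] at h'
  refine h'.congr' ?_
  filter_upwards [eventually_cobounded_eval_ne_zero hp,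
    eventually_cobounded_eval_ne_zero hq] with x hpx hqx
  exact div_mul_cancel₀ _ (div_ne_zero hpx hqx)

/-- The difference of two solutions of Painlevé-III satisfies a linear equation, written here
after division by that difference. -/
theorem PIIIat.deriv_deriv_sub_div {Θ0 Θinf : ℂ} {u v : ℂ → ℂ} {x : ℂ}
    (hu : PIIIat Θ0 Θinf u x) (hv : PIIIat Θ0 Θinf v x)
    (hux : u x ≠ 0) (hvx : v x ≠ 0) (huv : u x - v x ≠ 0) :
    (deriv (deriv u) x - deriv (deriv v) x) / (u x - v x) =
      (deriv u x - deriv v x) / (u x - v x) * ((deriv u x + deriv v x) / u x - x⁻¹)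
        - deriv v x ^ 2 / (u x * v x) + 4 * Θ0 * (u x + v x) * x⁻¹
        + 4 * (u x ^ 2 + u x * v x + v x ^ 2) + 4 / (u x * v x) := by
  rw [hu, hv, div_eq_iff huv]
  rcases eq_or_ne x 0 with rfl | hx
  · simp
    field_simp
    ring
  · field_simp
    ring

/-- Uniqueness of the rational solution of Painlevé-III (with `Θ0 = n + m`,
`Θinf = m - n + 1`) normalized so that `u(x) → 1` as `|x| → ∞`. -/
theorem rational_solution_normalized_at_infinity_unique (m : ℂ) (n : ℤ)
    (p₁ q₁ p₂ q₂ : Polynomial ℂ)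
    (h₁ : IsRatSolutionPIII ((n : ℂ) + m) (m - (n : ℂ) + 1) p₁ q₁)
    (h₂ : IsRatSolutionPIII ((n : ℂ) + m) (m - (n : ℂ) + 1) p₂ q₂)
    (hlim₁ : Filter.Tendsto (fun x : ℂ => p₁.eval x / q₁.eval x)
      (Bornology.cobounded ℂ) (nhds 1))
    (hlim₂ : Filter.Tendsto (fun x : ℂ => p₂.eval x / q₂.eval x)
      (Bornology.cobounded ℂ) (nhds 1)) :
    ∀ x : ℂ, q₁.eval x ≠ 0 → q₂.eval x ≠ 0 →
      p₁.eval x / q₁.eval x = p₂.eval x / q₂.eval x := by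
  obtain ⟨hp₁, hq₁, hu⟩ := h₁
  obtain ⟨hp₂, hq₂, hv⟩ := h₂
  intro x hx₁ hx₂
  set P := p₁ * q₂ - q₁ * p₂ with hP
  set u : ℂ → ℂ := fun y => p₁.eval y / q₁.eval y with hu_def
  set v : ℂ → ℂ := fun y => p₂.eval y / q₂.eval y with hv_def
  set d : ℂ → ℂ := fun y => P.eval y / (q₁ * q₂).eval y with hd_def
  have hd : ∀ y, q₁.eval y ≠ 0 → q₂.eval y ≠ 0 → d y = u y - v y := by
    intro y hy₁ hy₂
    simp only [hd_def, hu_def, hv_def, hP, eval_sub, eval_mul]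
    rw [div_sub_div _ _ hy₁ hy₂]
  rcases eq_or_ne P 0 with h0 | h0
  · refine sub_eq_zero.mp ((hd x hx₁ hx₂).symm.trans ?_)
    simp [hd_def, h0]
  exfalso
  have hq := mul_ne_zero hq₁ hq₂
  have hu' := tendsto_deriv_cobounded hp₁ hq₁ hlim₁
  have hv' := tendsto_deriv_cobounded hp₂ hq₂ hlim₂
  have hinv := tendsto_inv₀_cobounded (α := ℂ)
  have hrhs := ((((((tendsto_deriv_div_self_cobounded P hq).mul
    (((hu'.add hv').div hlim₁ one_ne_zero).sub hinv)).sub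
    ((hv'.pow 2).div (hlim₁.mul hlim₂) (by norm_num))).add
    (((hlim₁.add hlim₂).const_mul (4 * ((n : ℂ) + m))).mul hinv)).add
    ((((hlim₁.pow 2).add (hlim₁.mul hlim₂)).add (hlim₂.pow 2)).const_mul 4)).add
    ((tendsto_const_nhds (x := (4 : ℂ))).div (hlim₁.mul hlim₂) (by norm_num)))
  have hlhs := tendsto_deriv_deriv_div_self_cobounded P hq
  have heq := tendsto_nhds_unique (hlhs.congr' ?_) hrhs
  · norm_num at heq
  filter_upwards [eventually_cobounded_eval_ne_zero hp₁, eventually_cobounded_eval_ne_zero hq₁,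
    eventually_cobounded_eval_ne_zero hp₂, eventually_cobounded_eval_ne_zero hq₂,
    eventually_cobounded_eval_ne_zero h0,
    eventually_cobounded_eval_ne_zero X_ne_zero] with y hp₁y hq₁y hp₂y hq₂y hPy hy
  rw [eval_X] at hy
  have hdy : d y ≠ 0 := div_ne_zero hPy (by simp [hq₁y, hq₂y])
  have hd_nhds : d =ᶠ[nhds y] u - v := by
    filter_upwards [q₁.continuous.continuousAt.eventually_ne hq₁y,
      q₂.continuous.continuousAt.eventually_ne hq₂y] with z hz₁ hz₂ using hd z hz₁ hz₂
  have hua : AnalyticAt ℂ u y := analyticAt_eval_div_eval p₁ q₁ hq₁y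
  have hva : AnalyticAt ℂ v y := analyticAt_eval_div_eval p₂ q₂ hq₂y
  have hd'_nhds : deriv d =ᶠ[nhds y] deriv u - deriv v := by
    filter_upwards [hd_nhds.eventuallyEq_nhds, hua.eventually_analyticAt,
      hva.eventually_analyticAt] with z hz hzu hzv
    rw [hz.deriv_eq, deriv_sub hzu.differentiableAt hzv.differentiableAt, Pi.sub_apply]
  have hd'' : deriv (deriv d) y = deriv (deriv u) y - deriv (deriv v) y := by
    rw [hd'_nhds.deriv_eq, deriv_sub hua.deriv.differentiableAt hva.deriv.differentiableAt]
  have hd' := hd'_nhds.eq_of_nhds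
  have hdy_eq := hd y hq₁y hq₂y
  have key := (hu y hy hp₁y hq₁y).deriv_deriv_sub_div (hv y hy hp₂y hq₂y)
    (div_ne_zero hp₁y hq₁y) (div_ne_zero hp₂y hq₂y) (hdy_eq ▸ hdy)
  change deriv (deriv d) y / d y = deriv d y / d y * _ - _ + _ + _ + _
  rw [hd'', hd', hdy_eq]
  exact key
end

section
/- Zero-curvature formulation of the Painlevé-III Lax system: let D ⊆ ℂ be open and connected with 0 ∉ D, let Θ∞ ∈ ℂ, and let y, v, s, t : D → ℂ be differentiable (analytic). For x ∈ D and λ ∈ ℂ∖{0} define the 2×2 matrices A(λ;x) := (i·x/2)·σ₃ + (1/λ)·[[−Θ∞/2, y(x)],[v(x), Θ∞/2]] + (1/λ²)·[[i·x/2 − i·s(x)t(x), i·s(x)],[−i·t(x)·(s(x)t(x) − x), −i·x/2 + i·s(x)t(x)]] and B(λ;x) := (i·λ/2)·σ₃ + (1/x)·[[0, y(x)],[v(x), 0]] − (1/(λ·x))·[[i·x/2 − i·s(x)t(x), i·s(x)],[−i·t(x)·(s(x)t(x) − x), −i·x/2 + i·s(x)t(x)]], where σ₃ = diag(1,−1).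 Then the zero-curvature condition ∂A/∂x (λ;x) − ∂B/∂λ (λ;x) + A(λ;x)·B(λ;x) − B(λ;x)·A(λ;x) = 0 holds for all x ∈ D and all λ ≠ 0 if and only if (y, v, s, t) satisfies on D the system x·y' = −2x·s + Θ∞·y, x·v' = −2x·t·(s·t − x) − Θ∞·v, x·s' = (1 − Θ∞)·s − 2x·y + 4·y·s·t, x·t' = Θ∞·t − 2·y·t² + 2·v. -/
open Complex Matrix

/-- The coefficient matrix `A(λ;x)` of the Painlevé-III Lax pair. -/
noncomputable def laxA (Θinf : ℂ) (y v s t : ℂ → ℂ) (lam x : ℂ) :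
    Matrix (Fin 2) (Fin 2) ℂ :=
  (Complex.I * x / 2) • !![(1 : ℂ), 0; 0, -1]
    + lam⁻¹ • !![-Θinf / 2, y x; v x, Θinf / 2]
    + (lam ^ 2)⁻¹ •
        !![Complex.I * x / 2 - Complex.I * s x * t x, Complex.I * s x;
           -Complex.I * t x * (s x * t x - x), -(Complex.I * x / 2) + Complex.I * s x * t x]

/-- The coefficient matrix `B(λ;x)` of the Painlevé-III Lax pair. -/
noncomputable def laxB (y v s t : ℂ → ℂ) (lam x : ℂ) :
    Matrix (Fin 2) (Fin 2) ℂ :=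
  (Complex.I * lam / 2) • !![(1 : ℂ), 0; 0, -1]
    + x⁻¹ • !![0, y x; v x, 0]
    - (lam * x)⁻¹ •
        !![Complex.I * x / 2 - Complex.I * s x * t x, Complex.I * s x;
           -Complex.I * t x * (s x * t x - x), -(Complex.I * x / 2) + Complex.I * s x * t x]

/-- The derivative in `x` of the matrix `A(λ;x)`, computed entrywise. -/
theorem deriv_laxA {Θinf : ℂ} {y v s t : ℂ → ℂ} {x y' v' s' t' : ℂ} (lam : ℂ)
    (hy : HasDerivAt y y' x) (hv : HasDerivAt v v' x)
    (hs : HasDerivAt s s' x) (ht : HasDerivAt t t' x) :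
    (Matrix.of fun i j => deriv (fun x' => laxA Θinf y v s t lam x' i j) x) =
      (I / 2) • !![(1 : ℂ), 0; 0, -1] + lam⁻¹ • !![0, y'; v', 0]
        + (lam ^ 2)⁻¹ •
          !![I / 2 - I * (s' * t x + s x * t'), I * s';
             -I * (t' * (s x * t x - x) + t x * (s' * t x + s x * t' - 1)),
             -(I / 2) + I * (s' * t x + s x * t')] := by
  have hx := hasDerivAt_id x
  have hIx := (hx.const_mul I).div_const 2
  have hst := hs.mul ht
  have hIst := hst.const_mul I
  ext i j
  rw [Matrix.of_apply]
  fin_cases i <;> fin_cases j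
  · refine HasDerivAt.deriv (((hIx.add_const (lam⁻¹ * (-Θinf / 2))).add
      ((hIx.sub hIst).const_mul (lam ^ 2)⁻¹)).congr_deriv ?_ |>.congr_of_eventuallyEq
        (.of_forall fun z => ?_))
    · simp
    · simp [laxA, -mul_eq_mul_left_iff]
      ring
  · refine HasDerivAt.deriv (((hy.const_mul lam⁻¹).add
      ((hs.const_mul I).const_mul (lam ^ 2)⁻¹)).congr_deriv ?_ |>.congr_of_eventuallyEq
        (.of_forall fun z => ?_)) <;> simp [laxA]
  · refine HasDerivAt.deriv (((hv.const_mul lam⁻¹).add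
      (((ht.mul (hst.sub hx)).const_mul (-I)).const_mul (lam ^ 2)⁻¹)).congr_deriv ?_
        |>.congr_of_eventuallyEq (.of_forall fun z => ?_))
    · simp
    · simp [laxA, -mul_eq_mul_left_iff]
      ring
  · refine HasDerivAt.deriv (((hIx.neg.add_const (lam⁻¹ * (Θinf / 2))).add
      ((hIx.neg.add hIst).const_mul (lam ^ 2)⁻¹)).congr_deriv ?_ |>.congr_of_eventuallyEq
        (.of_forall fun z => ?_))
    · simp
    · simp [laxA, -mul_eq_mul_left_iff]
      ring

/-- The derivative in `λ` of the matrix `B(λ;x)`, computed entrywise. -/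
theorem deriv_laxB (y v s t : ℂ → ℂ) {lam : ℂ} (x : ℂ) (hlam : lam ≠ 0) :
    (Matrix.of fun i j => deriv (fun l => laxB y v s t l x i j) lam) =
      (I / 2) • !![(1 : ℂ), 0; 0, -1]
        + (lam ^ 2 * x)⁻¹ •
          !![I * x / 2 - I * s x * t x, I * s x;
             -I * t x * (s x * t x - x), -(I * x / 2) + I * s x * t x] := by
  have key (a b c : ℂ) : HasDerivAt (fun l : ℂ => I * l / 2 * a + b - (l * x)⁻¹ * c)
      (I / 2 * a + (lam ^ 2 * x)⁻¹ * c) lam := by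
    have h₁ := ((((hasDerivAt_id lam).const_mul I).div_const 2).mul_const a).add_const b
    have h₂ := (hasDerivAt_inv hlam).mul_const (x⁻¹ * c)
    refine (h₁.sub h₂).congr_deriv ?_ |>.congr_of_eventuallyEq (.of_forall fun z => ?_)
    · simp only [mul_inv]; ring
    · simp only [mul_inv, Pi.sub_apply, id]; ring
  ext i j
  rw [Matrix.of_apply]
  exact (key (!![(1 : ℂ), 0; 0, -1] i j) (x⁻¹ * !![0, y x; v x, 0] i j)
    (!![I * x / 2 - I * s x * t x, I * s x;
      -I * t x * (s x * t x - x), -(I * x / 2) + I * s x * t x] i j)).deriv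

/-- The curvature of the Lax pair, written in terms of the residuals of the four equations of
the potential system. -/
theorem laxCurvature_eq {Θinf : ℂ} {y v s t : ℂ → ℂ} {lam x y' v' s' t' ey ev es et : ℂ}
    (hx : x ≠ 0) (hlam : lam ≠ 0)
    (hy : HasDerivAt y y' x) (hv : HasDerivAt v v' x)
    (hs : HasDerivAt s s' x) (ht : HasDerivAt t t' x)
    (hey : x * y' = -2 * x * s x + Θinf * y x + ey)
    (hev : x * v' = -2 * x * t x * (s x * t x - x) - Θinf * v x + ev)
    (hes : x * s' = (1 - Θinf) * s x - 2 * x * y x + 4 * y x * s x * t x + es)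
    (het : x * t' = Θinf * t x - 2 * y x * (t x) ^ 2 + 2 * v x + et) :
    (Matrix.of fun i j => deriv (fun x' => laxA Θinf y v s t lam x' i j) x)
        - (Matrix.of fun i j => deriv (fun l => laxB y v s t l x i j) lam)
        + laxA Θinf y v s t lam x * laxB y v s t lam x
        - laxB y v s t lam x * laxA Θinf y v s t lam x =
      (lam * x)⁻¹ • !![0, ey; ev, 0]
        + (lam ^ 2 * x)⁻¹ •
          !![-I * (t x * es + s x * et), I * es;
             -I * (t x ^ 2 * es + (2 * s x * t x - x) * et), I * (t x * es + s x * et)] := by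
  rw [deriv_laxA lam hy hv hs ht, deriv_laxB y v s t x hlam]
  obtain rfl := eq_sub_of_add_eq' hey.symm
  obtain rfl := eq_sub_of_add_eq' hev.symm
  obtain rfl := eq_sub_of_add_eq' hes.symm
  obtain rfl := eq_sub_of_add_eq' het.symm
  ext i j
  fin_cases i <;> fin_cases j <;> simp [laxA, laxB] <;>
    field_simp <;> ring_nf <;> simp only [I_sq] <;> ring

/-- Zero-curvature formulation: `∂A/∂x − ∂B/∂λ + [A, B] = 0` for all `x ∈ D` and
`λ ≠ 0` if and only if `(y, v, s, t)` satisfies the Painlevé-III potential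
system on `D`. -/
theorem zero_curvature_iff_potential_system (D : Set ℂ) (hD : IsOpen D)
    (hconn : IsConnected D) (h0 : (0 : ℂ) ∉ D) (Θinf : ℂ) (y v s t : ℂ → ℂ)
    (hy : ∀ x ∈ D, DifferentiableAt ℂ y x)
    (hv : ∀ x ∈ D, DifferentiableAt ℂ v x)
    (hs : ∀ x ∈ D, DifferentiableAt ℂ s x)
    (ht : ∀ x ∈ D, DifferentiableAt ℂ t x) :
    (∀ x ∈ D, ∀ lam : ℂ, lam ≠ 0 →
        (Matrix.of fun i j => deriv (fun x' => laxA Θinf y v s t lam x' i j) x)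
          - (Matrix.of fun i j => deriv (fun l => laxB y v s t l x i j) lam)
          + laxA Θinf y v s t lam x * laxB y v s t lam x
          - laxB y v s t lam x * laxA Θinf y v s t lam x = 0)
      ↔ (∀ x ∈ D,
          x * deriv y x = -2 * x * s x + Θinf * y x ∧
          x * deriv v x = -2 * x * t x * (s x * t x - x) - Θinf * v x ∧
          x * deriv s x = (1 - Θinf) * s x - 2 * x * y x + 4 * y x * s x * t x ∧
          x * deriv t x = Θinf * t x - 2 * y x * (t x) ^ 2 + 2 * v x) := by
  refine forall₂_congr fun x hx => ?_
  have hx0 : x ≠ 0 := ne_of_mem_of_not_mem hx h0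
  have curv := fun (lam : ℂ) (hlam : lam ≠ 0) =>
    laxCurvature_eq (Θinf := Θinf) hx0 hlam (hy x hx).hasDerivAt (hv x hx).hasDerivAt
      (hs x hx).hasDerivAt (ht x hx).hasDerivAt (add_sub_cancel _ _).symm
      (add_sub_cancel _ _).symm (add_sub_cancel _ _).symm (add_sub_cancel _ _).symm
  constructor
  · intro h
    have h₁ := (curv 1 one_ne_zero).symm.trans (h 1 one_ne_zero)
    have h₂ := (curv (-1) (by norm_num)).symm.trans (h (-1) (by norm_num))
    simp only [← sub_eq_zero (a := x * _)]
    generalize x * deriv y x - _ = ey at *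
    generalize x * deriv v x - _ = ev at *
    generalize x * deriv s x - _ = es at *
    generalize x * deriv t x - _ = et at *
    have separate {a b : ℂ} (hp : (1 * x)⁻¹ * a + (1 ^ 2 * x)⁻¹ * b = 0)
        (hm : (-1 * x)⁻¹ * a + ((-1) ^ 2 * x)⁻¹ * b = 0) : a = 0 ∧ b = 0 := by
      field_simp at hp hm
      exact ⟨by linear_combination (hp - hm) / 2, by linear_combination (hp + hm) / 2⟩
    have h00 : -I * (t x * es + s x * et) = 0 :=
      (separate (congrFun₂ h₁ 0 0) (congrFun₂ h₂ 0 0)).2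
    obtain ⟨hey, hes⟩ : ey = 0 ∧ I * es = 0 :=
      separate (congrFun₂ h₁ 0 1) (congrFun₂ h₂ 0 1)
    obtain ⟨hev, h10⟩ : ev = 0 ∧ -I * (t x ^ 2 * es + (2 * s x * t x - x) * et) = 0 :=
      separate (congrFun₂ h₁ 1 0) (congrFun₂ h₂ 1 0)
    have hxet : I * x * et = 0 := by
      linear_combination h10 - 2 * t x * h00 - t x ^ 2 * hes
    exact ⟨hey, hev, by simpa using hes, by simpa [hx0] using hxet⟩
  · rintro ⟨h₁, h₂, h₃, h₄⟩ lam hlam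
    rw [curv lam hlam, h₁, h₂, h₃, h₄]
    ext i j
    fin_cases i <;> fin_cases j <;> simp
end
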